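/- (Robustness of BdInterp.) Let X be a real normed vector space, T a positive integer, x_0 ∈ X, and f_1, …, f_T : X → ℝ convex functions with f_t ≥ 0 everywhere. Let x̃_0 = x_0, x̃_1, …, x̃_T and s_0 = x_0, s_1, …, s_T be sequences in X, let γ > 0 and δ > 0, set ε = 2γ + 2δ, and suppose there is D > 0 with ‖x̃_t − s_t‖ ≤ D for all 1 ≤ t ≤ T and that C_s(1, T) ≥ 1. Let x_0, x_1, …, x_T be the BdInterp sequence determined by these data. Then C_x(1, T) ≤ (D + D/γ + (1 + ε)/δ)·C_s(1, T). -/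

import Mathlib

open scoped Classical

/-- The radial retraction onto the closed ball of radius `r`. -/
noncomputable def radial {X : Type*} [NormedAddCommGroup X] [NormedSpace ℝ X]
    (v : X) (r : ℝ) : X :=
  if ‖v‖ ≤ r then v else (r / ‖v‖) • v

/-- The cost of the sequence `z` over times `a` through `b`:
`C_z(a, b) = Σ_{t=a}^{b} (f_t(z_t) + ‖z_t − z_{t−1}‖)`. -/
noncomputable def cost {X : Type*} [NormedAddCommGroup X]
    (f : ℕ → X → ℝ) (z : ℕ → X) (a b : ℕ) : ℝ :=
  ∑ t ∈ Finset.Icc a b, (f t (z t) + ‖z t - z (t - 1)‖)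

/-- The coefficient of `x` along the segment from `s` to `a`, set to `0` when `a = s`. -/
noncomputable def segWeight {X : Type*} [NormedAddCommGroup X] (a s x : X) : ℝ :=
  if a = s then 0 else ‖x - s‖ / ‖a - s‖

theorem segWeight_nonneg {X : Type*} [NormedAddCommGroup X] (a s x : X) :
    0 ≤ segWeight a s x := by
  unfold segWeight
  split_ifs <;> positivity

theorem segWeight_self_le_one {X : Type*} [NormedAddCommGroup X] (a s : X) :
    segWeight a s a ≤ 1 := by
  unfold segWeight
  split_ifs
  · exact zero_le_one
  · exact div_self_le_one _

theorem eq_add_segWeight_self_smul {X : Type*} [NormedAddCommGroup X] [NormedSpace ℝ X]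
    (a s : X) : a = s + segWeight a s a • (a - s) := by
  unfold segWeight
  split_ifs with h
  · simp [h]
  · rw [div_self (norm_ne_zero_iff.mpr (sub_ne_zero.mpr h))]
    simp

theorem exists_radial_eq_smul {X : Type*} [NormedAddCommGroup X] [NormedSpace ℝ X]
    (v : X) {r : ℝ} (hr : 0 ≤ r) (hrv : r ≤ ‖v‖) :
    ∃ μ : ℝ, 0 ≤ μ ∧ μ ≤ 1 ∧ radial v r = μ • v ∧ μ * ‖v‖ = r := by
  unfold radial
  split_ifs with h
  · exact ⟨1, zero_le_one, le_rfl, (one_smul _ _).symm, by linarith⟩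
  · have hv : 0 < ‖v‖ := by linarith
    exact ⟨r / ‖v‖, by positivity, (div_le_one hv).mpr hrv, rfl, div_mul_cancel₀ _ hv.ne'⟩

/-- Retracting a point of the segment from `s` to `a` towards `s` by at most `c` lowers its
coefficient accordingly. -/
theorem segWeight_retract {X : Type*} [NormedAddCommGroup X] [NormedSpace ℝ X]
    {a s x y : X} {ν c : ℝ} (hν : 0 ≤ ν) (hc : 0 ≤ c) (hy : y = ν • a + (1 - ν) • s)
    (hx : x = s + radial (y - s) (max (‖y - s‖ - c) 0)) :
    x = s + segWeight a s x • (a - s) ∧ segWeight a s x ≤ ν ∧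
      (ν - segWeight a s x) * ‖a - s‖ ≤ c ∧
      (segWeight a s x = 0 ∨ c ≤ (ν - segWeight a s x) * ‖a - s‖) := by
  have hys : y - s = ν • (a - s) := by rw [hy]; module
  have hn : ‖y - s‖ = ν * ‖a - s‖ := by rw [hys, norm_smul, Real.norm_of_nonneg hν]
  obtain ⟨μ, hμ0, hμ1, hrad, hμ⟩ := exists_radial_eq_smul (y - s)
    (le_max_right (‖y - s‖ - c) 0) (max_le (by linarith) (norm_nonneg _))
  rw [hrad, hys, smul_smul] at hx
  by_cases h : a = s
  · subst h
    simp [segWeight, hx, hν, hc]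
  have hd : 0 < ‖a - s‖ := norm_pos_iff.mpr (sub_ne_zero.mpr h)
  have hw : segWeight a s x = μ * ν := by
    rw [segWeight, if_neg h, hx, add_sub_cancel_left, norm_smul,
      Real.norm_of_nonneg (mul_nonneg hμ0 hν), mul_div_cancel_right₀ _ hd.ne']
  rw [hw]
  rw [hn, ← mul_assoc] at hμ
  refine ⟨hx, mul_le_of_le_one_left hν hμ1, ?_, ?_⟩
  · linarith [le_max_left (ν * ‖a - s‖ - c) 0]
  · rcases max_cases (ν * ‖a - s‖ - c) 0 with ⟨hm, -⟩ | ⟨hm, -⟩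
    · right
      linarith
    · left
      rw [hm] at hμ
      exact (mul_eq_zero.mp hμ).resolve_right hd.ne'

section Segment

variable {X : Type*} [NormedAddCommGroup X] [NormedSpace ℝ X] {a a' s s' x x' : X} {l ν : ℝ}

theorem norm_sub_le_of_segment (hx : x = s + l • (a - s)) (hx' : x' = s' + ν • (a' - s'))
    (hν0 : 0 ≤ ν) (hν1 : ν ≤ 1) (hl : l ≤ ν) :
    ‖x - x'‖ ≤ (ν - l) * ‖a - s‖ + ν * ‖a - a'‖ + (1 - ν) * ‖s - s'‖ := by
  have e : x - x' = -((ν - l) • (a - s)) + ν • (a - a') + (1 - ν) • (s - s') := by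
    rw [hx, hx']; module
  rw [e]
  refine norm_add₃_le.trans_eq ?_
  rw [norm_neg, norm_smul, norm_smul, norm_smul, Real.norm_of_nonneg (sub_nonneg.mpr hl),
    Real.norm_of_nonneg hν0, Real.norm_of_nonneg (sub_nonneg.mpr hν1)]

theorem norm_sub_le_of_segment_left (hx' : x' = s' + ν • (a' - s')) (hν0 : 0 ≤ ν) :
    ‖s - x'‖ ≤ ‖s - s'‖ + ν * ‖a' - s'‖ := by
  have e : s - x' = (s - s') - ν • (a' - s') := by rw [hx']; module
  rw [e]
  refine (norm_sub_le _ _).trans_eq ?_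
  rw [norm_smul, Real.norm_of_nonneg hν0]

theorem norm_right_sub_le_of_segment (hx : x = s + l • (a - s))
    (hx' : x' = s' + ν • (a' - s')) (hν1 : ν ≤ 1) (hl : l ≤ ν) :
    ‖a - x‖ ≤ ‖a' - x'‖ + (1 - ν) * (‖a - a'‖ + ‖s - s'‖) + (ν - l) * ‖a - s‖ := by
  have e : a - x = (a' - x') + (1 - ν) • ((a - a') - (s - s')) + (ν - l) • (a - s) := by
    rw [hx, hx']; module
  rw [e]
  refine norm_add₃_le.trans ?_
  rw [norm_smul, norm_smul, Real.norm_of_nonneg (sub_nonneg.mpr hν1),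
    Real.norm_of_nonneg (sub_nonneg.mpr hl)]
  gcongr
  exact norm_sub_le _ _

theorem ConvexOn.le_of_segment {g : X → ℝ} (hg : ConvexOn ℝ Set.univ g)
    (hx : x = s + l • (a - s)) (hl0 : 0 ≤ l) (hl1 : l ≤ 1) :
    g x ≤ l * g a + (1 - l) * g s := by
  have e : x = l • a + (1 - l) • s := by rw [hx]; module
  rw [e]
  exact hg.2 trivial trivial hl0 (sub_nonneg.mpr hl1) (by ring)

/-- Cost plus change of the distance to `a` in one interpolation step. -/
theorem segment_step_cost_add_dist_le {g : X → ℝ} {γ : ℝ} (hg : ConvexOn ℝ Set.univ g)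
    (hg0 : ∀ p, 0 ≤ g p) (hx : x = s + l • (a - s)) (hx' : x' = s' + ν • (a' - s'))
    (hl0 : 0 ≤ l) (hν1 : ν ≤ 1) (hl : l ≤ ν)
    (hc : (ν - l) * ‖a - s‖ ≤ γ * (g a + ‖a - a'‖)) :
    g x + ‖x - x'‖ + ‖a - x‖ ≤
      ‖a' - x'‖ + (1 + 2 * γ) * (g a + ‖a - a'‖) + 2 * (g s + ‖s - s'‖) := by
  have h1 := norm_sub_le_of_segment hx hx' (hl0.trans hl) hν1 hl
  have h2 := norm_right_sub_le_of_segment hx hx' hν1 hl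
  have h3 := hg.le_of_segment hx hl0 (hl.trans hν1)
  have h4 := mul_le_of_le_one_left (hg0 a) (hl.trans hν1)
  have h5 := mul_nonneg hl0 (hg0 s)
  have h6 := mul_nonneg (hl0.trans hl) (norm_nonneg (s - s'))
  linarith [hg0 s]

/-- Cost of one interpolation step in terms of the decrease of the coefficient. -/
theorem segment_step_cost_le {g : X → ℝ} {γ D : ℝ} (hγ : 0 < γ)
    (hg : ConvexOn ℝ Set.univ g)
    (hg0 : ∀ p, 0 ≤ g p) (hx : x = s + l • (a - s)) (hx' : x' = s' + ν • (a' - s'))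
    (hl0 : 0 ≤ l) (hν1 : ν ≤ 1) (hl : l ≤ ν)
    (hD : ‖a - s‖ ≤ D) (hD' : ‖a' - s'‖ ≤ D)
    (hc : l = 0 ∨ γ * (g a + ‖a - a'‖) ≤ (ν - l) * ‖a - s‖) :
    g x + ‖x - x'‖ ≤ g s + ‖s - s'‖ + (ν - l) * (D + D / γ) := by
  have hν0 := hl0.trans hl
  have hD0 : 0 ≤ D := (norm_nonneg _).trans hD
  rcases hc with rfl | hc
  · have e : x = s := by rw [hx]; simp
    have h1 := norm_sub_le_of_segment_left (s := s) hx' hν0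
    have h2 := mul_le_mul_of_nonneg_left hD' hν0
    have h3 : 0 ≤ ν * (D / γ) := by positivity
    rw [e]
    linarith
  · have h1 := norm_sub_le_of_segment hx hx' hν0 hν1 hl
    have h3 := hg.le_of_segment hx hl0 (hl.trans hν1)
    have h4 := mul_le_of_le_one_left (hg0 a) (hl.trans hν1)
    have h5 := mul_nonneg hl0 (hg0 s)
    have h6 := mul_nonneg hν0 (norm_nonneg (s - s'))
    have h7 := mul_le_mul_of_nonneg_left hD (sub_nonneg.mpr hl)
    have h8 : g a + ‖a - a'‖ ≤ (ν - l) * (D / γ) := by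
      rw [← mul_div_assoc, le_div_iff₀ hγ]
      linarith
    have h9 := mul_le_of_le_one_left (norm_nonneg (a - a')) hν1
    linarith

end Segment

theorem cost_one_zero {X : Type*} [NormedAddCommGroup X] (f : ℕ → X → ℝ) (z : ℕ → X) :
    cost f z 1 0 = 0 := by
  simp [cost]

theorem cost_one_succ {X : Type*} [NormedAddCommGroup X] (f : ℕ → X → ℝ) (z : ℕ → X) (n : ℕ) :
    cost f z 1 (n + 1) = cost f z 1 n + (f (n + 1) (z (n + 1)) + ‖z (n + 1) - z n‖) := by
  simp [cost, Finset.sum_Icc_succ_top]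

/-- **Robustness of BdInterp.** Given convex nonnegative hitting costs
`f_1, …, f_T`, an advice sequence `adv` and a robust sequence `s` (both starting at
`x₀`) that are `D`-bounded, with `C_s(1, T) ≥ 1`, and parameters `γ, δ > 0` with
`ε = 2γ + 2δ`, the BdInterp sequence `x` satisfies `C_x(1, T) ≤ (D + D/γ + (1 + ε)/δ)·C_s(1, T)`. -/
theorem bdinterp_robustness
    {X : Type*} [NormedAddCommGroup X] [NormedSpace ℝ X]
    (T : ℕ) (hT : 1 ≤ T) (x₀ : X) (f : ℕ → X → ℝ)
    (hconv : ∀ t ∈ Finset.Icc 1 T, ConvexOn ℝ Set.univ (f t))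
    (hnn : ∀ t ∈ Finset.Icc 1 T, ∀ p : X, 0 ≤ f t p)
    (adv s x : ℕ → X)
    (hadv0 : adv 0 = x₀) (hs0 : s 0 = x₀) (hx0 : x 0 = x₀)
    (γ δ ε : ℝ) (hγ : 0 < γ) (hδ : 0 < δ) (hε : ε = 2 * γ + 2 * δ)
    (D : ℝ) (hD : 0 < D) (hbdd : ∀ t ∈ Finset.Icc 1 T, ‖adv t - s t‖ ≤ D)
    (hrob1 : 1 ≤ cost f s 1 T)
    (hstep : ∀ t ∈ Finset.Icc 1 T,
      x t =
        if δ * cost f adv 1 t ≤ cost f s 1 t then adv t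
        else
          let Δ := f t (adv t) + ‖adv t - adv (t - 1)‖
          let ν : ℝ :=
            if adv (t - 1) = s (t - 1) then 0
            else ‖x (t - 1) - s (t - 1)‖ / ‖adv (t - 1) - s (t - 1)‖
          let y := ν • adv t + (1 - ν) • s t
          s t + radial (y - s t) (max (‖y - s t‖ - γ * Δ) 0)) :
    cost f x 1 T ≤ (D + D / γ + (1 + ε) / δ) * cost f s 1 T := by
  have hbdd' : ∀ t ≤ T, ‖adv t - s t‖ ≤ D := by
    intro t ht
    rcases Nat.eq_zero_or_pos t with rfl | h
    · simpa [hadv0, hs0] using hD.le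
    · exact hbdd t (Finset.mem_Icc.mpr ⟨h, ht⟩)
  have hcoef : 1 ≤ (1 + ε) / δ := by
    rw [le_div_iff₀ hδ]
    linarith
  have hK : 0 ≤ D + D / γ := by positivity
  have inv : ∀ t ≤ T,
      x t = s t + segWeight (adv t) (s t) (x t) • (adv t - s t) ∧
      segWeight (adv t) (s t) (x t) ≤ 1 ∧
      cost f x 1 t + ‖adv t - x t‖ ≤ (1 + 2 * γ) * cost f adv 1 t + 2 * cost f s 1 t ∧
      cost f x 1 t + ‖adv t - x t‖ ≤ (1 + ε) * cost f adv 1 t ∧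
      cost f x 1 t ≤ (1 + ε) / δ * cost f s 1 t +
        (1 - segWeight (adv t) (s t) (x t)) * (D + D / γ) := by
    intro t
    induction t with
    | zero =>
      intro _
      simp only [cost_one_zero, hadv0, hs0, hx0, segWeight]
      simpa using hK
    | succ n ih =>
      intro hn
      obtain ⟨hx', hν1, hP, hQ, hR⟩ := ih (by omega)
      have hmem : n + 1 ∈ Finset.Icc 1 T := Finset.mem_Icc.mpr ⟨by omega, hn⟩
      have hg := hconv _ hmem
      have hg0 := hnn _ hmem
      have hst := hstep _ hmem
      have hν0 := segWeight_nonneg (adv n) (s n) (x n)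
      have hΔ : 0 ≤ f (n + 1) (adv (n + 1)) + ‖adv (n + 1) - adv n‖ :=
        add_nonneg (hg0 _) (norm_nonneg _)
      have hS : 0 ≤ f (n + 1) (s (n + 1)) + ‖s (n + 1) - s n‖ :=
        add_nonneg (hg0 _) (norm_nonneg _)
      have hγΔ := mul_nonneg hγ.le hΔ
      have hδΔ := mul_nonneg hδ.le hΔ
      have hxs := cost_one_succ f x n
      have has := cost_one_succ f adv n
      have hss := cost_one_succ f s n
      by_cases hA : δ * cost f adv 1 (n + 1) ≤ cost f s 1 (n + 1)
      · rw [if_pos hA] at hst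
        have htri : ‖adv (n + 1) - x n‖ ≤ ‖adv (n + 1) - adv n‖ + ‖adv n - x n‖ :=
          norm_sub_le_norm_sub_add_norm_sub _ _ _
        rw [hst] at hxs
        have hw := segWeight_self_le_one (adv (n + 1)) (s (n + 1))
        have hQ' : cost f x 1 (n + 1) ≤ (1 + ε) * cost f adv 1 (n + 1) := by
          rw [hxs, has, hε]
          rw [hε] at hQ
          linarith
        rw [hst, sub_self, norm_zero, add_zero]
        refine ⟨eq_add_segWeight_self_smul _ _, hw, ?_, hQ', ?_⟩
        · rw [hxs, has, hss]
          linarith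
        · have h1 : (1 + ε) * cost f adv 1 (n + 1) ≤ (1 + ε) / δ * cost f s 1 (n + 1) := by
            rw [div_mul_eq_mul_div, le_div_iff₀ hδ]
            have := mul_le_mul_of_nonneg_left hA (show 0 ≤ 1 + ε by linarith)
            linarith
          have h2 := mul_nonneg (sub_nonneg.mpr hw) hK
          linarith
      · rw [if_neg hA] at hst
        obtain ⟨hx, hl, hc, hc'⟩ := segWeight_retract hν0 hγΔ rfl hst
        have hl0 := segWeight_nonneg (adv (n + 1)) (s (n + 1)) (x (n + 1))
        have h1 := segment_step_cost_add_dist_le hg hg0 hx hx' hl0 hν1 hl hc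
        have h2 := segment_step_cost_le hγ hg hg0 hx hx' hl0 hν1 hl (hbdd' _ hn)
          (hbdd' n (by omega)) hc'
        have hP' : cost f x 1 (n + 1) + ‖adv (n + 1) - x (n + 1)‖ ≤
            (1 + 2 * γ) * cost f adv 1 (n + 1) + 2 * cost f s 1 (n + 1) := by
          rw [hxs, has, hss]
          linarith
        refine ⟨hx, hl.trans hν1, hP', ?_, ?_⟩
        · rw [hε]
          linarith
        · have h3 := mul_le_mul_of_nonneg_right hcoef hS
          rw [hxs, hss]
          linarith
  obtain ⟨-, -, -, -, hR⟩ := inv T le_rfl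
  have h1 := mul_nonneg (segWeight_nonneg (adv T) (s T) (x T)) hK
  have h2 := mul_le_mul_of_nonneg_left hrob1 hK
  linarith
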